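/- In the two-qubit entanglement swapping setup, fix i ∈ {1,2,3,4} with p_i > 0 and let X be the random variable on {0,1}² with Pr[X = x] = |uⁱ_x|²·|a_{x₁}|²·|b_{x₂}|²/p_i, and let odd(X) := X₁ ⊕ X₂ ∈ {0,1}. Then the post-measurement entropy satisfies S(ρⁱ) ≤ H(X | odd(X)), where H(X | odd(X)) = ∑_{o∈{0,1}} Pr[odd(X)=o] · H(distribution of X conditioned on odd(X)=o) is the conditional Shannon entropy in nats. -/

import Mathlib

open Classical

/-- Von Neumann entropy (natural log) of a matrix, via the eigenvalues of a
Hermitian matrix; junk value 0 for non-Hermitian matrices. -/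
noncomputable def vnEntropy {n : Type*} [Fintype n] [DecidableEq n] (ρ : Matrix n n ℂ) : ℝ :=
  if h : ρ.IsHermitian then ∑ i, Real.negMulLog (h.eigenvalues i) else 0

open Real in
/-- The function `arsinh v / v` is antitone on the positive reals. -/
lemma antitoneOn_arsinh_div : AntitoneOn (fun v : ℝ => arsinh v / v) (Set.Ioi 0) := by
  have hconv : ConvexOn ℝ (Set.Ici 0) sinh := by
    refine MonotoneOn.convexOn_of_deriv (convex_Ici 0) continuous_sinh.continuousOn
      differentiable_sinh.differentiableOn ?_
    rw [Real.deriv_sinh, interior_Ici]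
    intro x hx y hy hxy
    have hx0 : (0 : ℝ) < x := hx
    have hy0 : (0 : ℝ) < y := hy
    rwa [cosh_le_cosh, abs_of_pos hx0, abs_of_pos hy0]
  intro v hv w hw hvw
  have hv0 : (0 : ℝ) < v := hv
  have hw0 : (0 : ℝ) < w := hw
  have hav := arsinh_pos_iff.2 hv0
  have haw := arsinh_pos_iff.2 hw0
  have h := hconv.secant_mono (a := 0) Set.self_mem_Ici (Set.mem_Ici.2 hav.le)
    (Set.mem_Ici.2 haw.le) hav.ne' haw.ne' (arsinh_le_arsinh.2 hvw)
  simp only [sinh_arsinh, sinh_zero, sub_zero] at h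
  rw [div_le_div_iff₀ hav haw] at h
  change arsinh w / w ≤ arsinh v / v
  rw [div_le_div_iff₀ hw0 hv0]
  linarith

/-- The binary entropy as a function of the concurrence `c = 2 √(p (1 - p))`. -/
noncomputable def concurrenceEntropy (c : ℝ) : ℝ :=
  Real.binEntropy ((1 - √(1 - c ^ 2)) / 2)

open Real in
lemma hasDerivAt_concurrenceEntropy {c : ℝ} (h0 : 0 < c) (h1 : c < 1) :
    HasDerivAt concurrenceEntropy (arsinh (√(1 - c ^ 2) / c) / (√(1 - c ^ 2) / c)) c := by
  have hpos : 0 < 1 - c ^ 2 := by nlinarith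
  have hs : 0 < √(1 - c ^ 2) := sqrt_pos.2 hpos
  have hsq : √(1 - c ^ 2) ^ 2 = 1 - c ^ 2 := sq_sqrt hpos.le
  have hs1 : √(1 - c ^ 2) < 1 := by nlinarith
  have hinner : HasDerivAt (fun c : ℝ => (1 - √(1 - c ^ 2)) / 2) (c / (2 * √(1 - c ^ 2))) c := by
    have := ((((hasDerivAt_pow 2 c).const_sub 1).sqrt hpos.ne').const_sub 1).div_const 2
    convert! this using 1
    field_simp
    norm_num [mul_comm]
  have hcomp := (hasDerivAt_binEntropy (p := (1 - √(1 - c ^ 2)) / 2)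
    (by linarith) (by linarith)).comp c hinner
  convert! hcomp using 1
  generalize √(1 - c ^ 2) = s at *
  have hroot : √(1 + (s / c) ^ 2) = 1 / c := by
    rw [show 1 + (s / c) ^ 2 = (1 / c) ^ 2 by field_simp; linarith, sqrt_sq (by positivity)]
  have hlog : log (1 - (1 - s) / 2) - log ((1 - s) / 2) = 2 * arsinh (s / c) := by
    rw [arsinh, hroot, ← log_div (by linarith) (by linarith), ← Nat.cast_ofNat, ← log_pow]
    congr 1
    have : 1 - s ≠ 0 := by linarith
    field_simp
    linear_combination (1 + s) * hsq
  rw [hlog]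
  field_simp

open Real in
lemma convexOn_concurrenceEntropy : ConvexOn ℝ (Set.Icc 0 1) concurrenceEntropy := by
  refine MonotoneOn.convexOn_of_deriv (convex_Icc 0 1) ?_ ?_ ?_
  · unfold concurrenceEntropy
    fun_prop
  · rw [interior_Icc]
    exact fun c hc => (hasDerivAt_concurrenceEntropy hc.1 hc.2).differentiableAt
      |>.differentiableWithinAt
  · rw [interior_Icc]
    rintro c ⟨hc0, hc1⟩ d ⟨hd0, hd1⟩ hcd
    rw [(hasDerivAt_concurrenceEntropy hc0 hc1).deriv,
      (hasDerivAt_concurrenceEntropy hd0 hd1).deriv]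
    have hd : 0 < 1 - d ^ 2 := by nlinarith
    have hc : 0 < 1 - c ^ 2 := by nlinarith
    refine antitoneOn_arsinh_div (Set.mem_Ioi.2 (by positivity)) (Set.mem_Ioi.2 (by positivity)) ?_
    gcongr

lemma monotoneOn_concurrenceEntropy : MonotoneOn concurrenceEntropy (Set.Icc 0 1) := by
  rintro c ⟨hc0, hc1⟩ d ⟨hd0, hd1⟩ hcd
  have hc : √(1 - c ^ 2) ≤ 1 := Real.sqrt_le_one.2 (by nlinarith)
  have hd : √(1 - d ^ 2) ≤ 1 := Real.sqrt_le_one.2 (by nlinarith)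
  have hc' := Real.sqrt_nonneg (1 - c ^ 2)
  have hd' := Real.sqrt_nonneg (1 - d ^ 2)
  refine Real.binEntropy_strictMonoOn.monotoneOn ⟨by linarith, by linarith⟩
    ⟨by linarith, by linarith⟩ ?_
  gcongr

lemma concurrenceEntropy_two_mul_sqrt {p : ℝ} (h0 : 0 ≤ p) (h1 : p ≤ 1) :
    concurrenceEntropy (2 * √(p * (1 - p))) = Real.binEntropy p := by
  have h : √(1 - (2 * √(p * (1 - p))) ^ 2) = |1 - 2 * p| := by
    rw [mul_pow, Real.sq_sqrt (mul_nonneg h0 (by linarith)), ← Real.sqrt_sq_eq_abs]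
    congr 1
    ring
  rw [concurrenceEntropy, h]
  rcases abs_cases (1 - 2 * p) with ⟨h, -⟩ | ⟨h, -⟩ <;> rw [h]
  · congr 1
    ring
  · rw [← Real.binEntropy_one_sub]
    congr 1
    ring

lemma two_mul_sqrt_mul_one_sub_mem_Icc {p : ℝ} : 2 * √(p * (1 - p)) ∈ Set.Icc (0 : ℝ) 1 := by
  refine ⟨by positivity, ?_⟩
  have : √(p * (1 - p)) ≤ 1 / 2 :=
    Real.sqrt_le_iff.2 ⟨by norm_num, by nlinarith [sq_nonneg (2 * p - 1)]⟩
  linarith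

/-- Convexity of the binary entropy in the concurrence. -/
lemma binEntropy_le_of_sqrt_le {l q r s t : ℝ} (hl : l ∈ Set.Icc (0 : ℝ) 1)
    (hs : s ∈ Set.Icc (0 : ℝ) 1) (ht : t ∈ Set.Icc (0 : ℝ) 1) (hq : 0 ≤ q) (hr : 0 ≤ r)
    (hqr : q + r = 1)
    (h : √(l * (1 - l)) ≤ q * √(s * (1 - s)) + r * √(t * (1 - t))) :
    Real.binEntropy l ≤ q * Real.binEntropy s + r * Real.binEntropy t := by
  rw [← concurrenceEntropy_two_mul_sqrt hl.1 hl.2, ← concurrenceEntropy_two_mul_sqrt hs.1 hs.2,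
    ← concurrenceEntropy_two_mul_sqrt ht.1 ht.2]
  have hs' := two_mul_sqrt_mul_one_sub_mem_Icc (p := s)
  have ht' := two_mul_sqrt_mul_one_sub_mem_Icc (p := t)
  refine (monotoneOn_concurrenceEntropy two_mul_sqrt_mul_one_sub_mem_Icc
    (convex_Icc (0 : ℝ) 1 hs' ht' hq hr hqr) ?_).trans
    (convexOn_concurrenceEntropy.2 hs' ht' hq hr hqr)
  simp only [smul_eq_mul]
  linarith

lemma mul_negMulLog_div_add (x y : ℝ) :
    (x + y) * (Real.negMulLog (x / (x + y)) + Real.negMulLog (y / (x + y))) =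
      (x + y) * Real.binEntropy (x / (x + y)) := by
  by_cases h : x + y = 0
  · simp [h]
  · rw [Real.binEntropy_eq_negMulLog_add_negMulLog_one_sub]
    congr 4
    field_simp
    ring

lemma add_mul_sqrt_div_add {x y : ℝ} (hx : 0 ≤ x) (hy : 0 ≤ y) :
    (x + y) * √(x / (x + y) * (1 - x / (x + y))) = √(x * y) := by
  rcases (add_nonneg hx hy).eq_or_lt with h | h
  · have : x = 0 := by linarith
    simp [this]
  · rw [← Real.sqrt_sq h.le, ← Real.sqrt_mul (by positivity), Real.sqrt_sq h.le]
    congr 1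
    field_simp
    ring

/-- The entropy of a `2 × 2` density matrix is the binary entropy of an eigenvalue `l`,
where `l (1 - l)` is the determinant. -/
lemma exists_vnEntropy_eq_binEntropy {ρ : Matrix (Fin 2) (Fin 2) ℂ} (hρ : ρ.IsHermitian)
    (htr : ρ.trace = 1) {d : ℝ} (hdet : ρ.det = d) (hd : 0 ≤ d) :
    ∃ l ∈ Set.Icc (0 : ℝ) 1, l * (1 - l) = d ∧ vnEntropy ρ = Real.binEntropy l := by
  have h1 := hρ.trace_eq_sum_eigenvalues
  have h2 := hρ.det_eq_prod_eigenvalues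
  rw [htr, Fin.sum_univ_two] at h1
  rw [hdet, Fin.prod_univ_two] at h2
  have h1' : 1 = hρ.eigenvalues 0 + hρ.eigenvalues 1 := Complex.ofReal_injective (by simpa using h1)
  have h2' : d = hρ.eigenvalues 0 * hρ.eigenvalues 1 := Complex.ofReal_injective (by simpa using h2)
  have h3 : hρ.eigenvalues 1 = 1 - hρ.eigenvalues 0 := by linarith
  rw [h3] at h2'
  refine ⟨hρ.eigenvalues 0, ⟨?_, ?_⟩, h2'.symm, ?_⟩
  · nlinarith [sq_nonneg (hρ.eigenvalues 0)]
  · nlinarith [sq_nonneg (1 - hρ.eigenvalues 0)]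
  · rw [vnEntropy, dif_pos hρ, Fin.sum_univ_two, h3,
      Real.binEntropy_eq_negMulLog_add_negMulLog_one_sub]

/-- In the two-qubit entanglement swapping setup, the post-measurement entropy
is bounded by the conditional Shannon entropy H(X | odd(X)) of the measurement
outcome random variable X (in nats). -/
theorem entropy_le_condEntropy_given_parity
    (a b : Fin 2 → ℂ)
    (ha : ‖a 0‖ ^ 2 + ‖a 1‖ ^ 2 = 1) (hb : ‖b 0‖ ^ 2 + ‖b 1‖ ^ 2 = 1)
    (u : Fin 4 → Fin 2 × Fin 2 → ℂ)
    (hu : ∀ i j : Fin 4,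
      ∑ x : Fin 2 × Fin 2, (starRingEnd ℂ) (u i x) * u j x = if i = j then 1 else 0)
    (p : Fin 4 → ℝ)
    (hp : ∀ i, p i = ∑ x : Fin 2 × Fin 2, ‖u i x‖ ^ 2 * ‖a x.1‖ ^ 2 * ‖b x.2‖ ^ 2)
    (ρ : Fin 4 → Matrix (Fin 2) (Fin 2) ℂ)
    (hρ : ∀ i, ∀ k k' : Fin 2, ρ i k k' = ((p i : ℝ) : ℂ)⁻¹ *
      (a k * (starRingEnd ℂ) (a k') *
        ∑ m : Fin 2, (starRingEnd ℂ) (u i (k, m)) * u i (k', m) * ((‖b m‖ ^ 2 : ℝ) : ℂ)))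
    (i : Fin 4) (hpi : 0 < p i)
    (Pr : Fin 2 × Fin 2 → ℝ)
    (hPr : ∀ x, Pr x = ‖u i x‖ ^ 2 * ‖a x.1‖ ^ 2 * ‖b x.2‖ ^ 2 / p i) :
    vnEntropy (ρ i) ≤
      ∑ o : Fin 2,
        (∑ x : Fin 2 × Fin 2, if x.1 + x.2 = o then Pr x else 0) *
          (∑ x : Fin 2 × Fin 2, Real.negMulLog
            (if x.1 + x.2 = o then
              Pr x / (∑ y : Fin 2 × Fin 2, if y.1 + y.2 = o then Pr y else 0)
            else 0)) := by
  have hPnn : ∀ x, 0 ≤ Pr x := fun x => by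
    rw [hPr]
    positivity
  have hpC : ((p i : ℝ) : ℂ) ≠ 0 := by exact_mod_cast hpi.ne'
  have hsum : Pr (0, 0) + Pr (1, 1) + (Pr (0, 1) + Pr (1, 0)) = 1 := by
    have h := hp i
    simp only [Fintype.sum_prod_type, Fin.sum_univ_two] at h
    simp only [hPr]
    field_simp
    linarith
  have hherm : (ρ i).IsHermitian := by
    ext k k'
    rw [Matrix.conjTranspose_apply, hρ, hρ]
    simp only [Fin.sum_univ_two, RCLike.star_def, map_mul, map_add, map_inv₀, Complex.conj_conj,
      Complex.conj_ofReal]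
    ring
  have htr : (ρ i).trace = 1 := by
    have h : ((p i : ℝ) : ℂ) = _ := congrArg Complex.ofReal (hp i)
    simp only [Fintype.sum_prod_type, Fin.sum_univ_two] at h
    push_cast at h
    simp only [← Complex.conj_mul'] at h
    rw [Matrix.trace_fin_two, hρ, hρ, ← mul_add, inv_mul_eq_one₀ hpC, h]
    simp only [Fin.sum_univ_two]
    push_cast
    simp only [← Complex.conj_mul']
    ring
  set K : ℝ := ‖a 0‖ * ‖a 1‖ * ‖b 0‖ * ‖b 1‖ / p i with hK
  have hK0 : 0 ≤ K := by positivity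
  set D : ℂ := u i (0, 0) * u i (1, 1) - u i (0, 1) * u i (1, 0) with hD
  have hdet : (ρ i).det = (((K * ‖D‖) ^ 2 : ℝ) : ℂ) := by
    have hDD := Complex.conj_mul' D
    rw [Matrix.det_fin_two, hρ, hρ, hρ, hρ]
    push_cast
    rw [mul_pow, ← hDD, hK, hD]
    push_cast
    rw [div_pow]
    simp only [mul_pow, ← Complex.conj_mul', map_sub, map_mul, Fin.sum_univ_two]
    field_simp
    ring
  obtain ⟨l, hl, hld, hS⟩ := exists_vnEntropy_eq_binEntropy hherm htr hdet (sq_nonneg _)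
  have hsqrt (x y : Fin 2 × Fin 2) (h : ‖a x.1‖ * ‖a y.1‖ * (‖b x.2‖ * ‖b y.2‖) / p i = K) :
      √(Pr x * Pr y) = K * (‖u i x‖ * ‖u i y‖) := by
    rw [hPr, hPr, ← h, ← Real.sqrt_sq (by positivity : 0 ≤ ‖a x.1‖ * ‖a y.1‖ *
      (‖b x.2‖ * ‖b y.2‖) / p i * (‖u i x‖ * ‖u i y‖))]
    congr 1
    ring
  have hfrac {x y : ℝ} (hx : 0 ≤ x) (hy : 0 ≤ y) : x / (x + y) ∈ Set.Icc (0 : ℝ) 1 :=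
    ⟨by positivity, div_le_one_of_le₀ (by linarith) (by linarith)⟩
  have hmain := binEntropy_le_of_sqrt_le hl (hfrac (hPnn (0, 0)) (hPnn (1, 1)))
    (hfrac (hPnn (0, 1)) (hPnn (1, 0))) (add_nonneg (hPnn _) (hPnn _))
    (add_nonneg (hPnn _) (hPnn _)) hsum (by
      rw [hld, Real.sqrt_sq (by positivity), add_mul_sqrt_div_add (hPnn _) (hPnn _),
        add_mul_sqrt_div_add (hPnn _) (hPnn _), hsqrt (0, 0) (1, 1) (by rw [hK]; ring),
        hsqrt (0, 1) (1, 0) (by rw [hK]; ring), ← mul_add, ← norm_mul, ← norm_mul]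
      exact mul_le_mul_of_nonneg_left (norm_sub_le _ _) hK0)
  rw [hS]
  refine hmain.trans_eq ?_
  rw [← mul_negMulLog_div_add, ← mul_negMulLog_div_add]
  simp [Fintype.sum_prod_type, Fin.sum_univ_two]
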